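/- The transfer Λ : 𝔐 → 𝔐, defined by d_1(t) = 0, d_{n+1}(t) = d_n(t) + 1 if t_{n+1} ≤ d_n(t) and d_n(t) otherwise, and Λ(t)_n = t_{n+1} if t_{n+1} ≤ d_n(t), Λ(t)_n = t_{n+1} − 1 otherwise, is a measurable measure-preserving transformation of the probability space (𝔐, μ), where μ is the product of the uniform measures on the factors {0,…,n−1}; moreover Λ is ergodic with respect to μ. -/

import Mathlib

open MeasureTheory

/-- The recursively defined sequence `d_n(t)` of the paper (in 0-based indexing,
`dM t m` is the paper's `d_{m+1}(t)`): `d_1(t) = 0`, and `d_{n+1}(t) = d_n(t) + 1` if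
position `n+1` is special (`t_{n+1} ≤ d_n(t)`), `d_{n+1}(t) = d_n(t)` otherwise. -/
def dM (t : ∀ n : ℕ, Fin (n + 1)) : ℕ → ℕ
  | 0 => 0
  | n + 1 => if (t (n + 1) : ℕ) ≤ dM t n then dM t n + 1 else dM t n

theorem dM_le (t : ∀ n : ℕ, Fin (n + 1)) : ∀ n, dM t n ≤ n
  | 0 => le_refl 0
  | n + 1 => by
    unfold dM
    split
    · exact Nat.succ_le_succ (dM_le t n)
    · exact (dM_le t n).trans (Nat.le_succ n)

/-- The transfer `Λ : 𝔐 → 𝔐` on the triangular compact set (in 0-based indexing,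
`transferM t m` is the paper's `Λ(t)_{m+1}`): `Λ(t)_n = t_{n+1}` if `t_{n+1}` is special
(`t_{n+1} ≤ d_n(t)`), and `Λ(t)_n = t_{n+1} - 1` otherwise. -/
def transferM (t : ∀ n : ℕ, Fin (n + 1)) (m : ℕ) : Fin (m + 1) :=
  if h : (t (m + 1) : ℕ) ≤ dM t m then
    ⟨(t (m + 1) : ℕ), Nat.lt_succ_of_le (h.trans (dM_le t m))⟩
  else
    ⟨(t (m + 1) : ℕ) - 1,
      Nat.lt_succ_of_le (Nat.sub_le_sub_right (Nat.lt_succ_iff.mp (t (m + 1)).isLt) 1)⟩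

/-- The uniform probability measure on `{0, 1, …, n}`. -/
noncomputable def uniformFin (n : ℕ) : Measure (Fin (n + 1)) :=
  (PMF.uniformOfFintype (Fin (n + 1))).toMeasure

namespace TransferAux

open ProbabilityTheory

/-- number of earlier indices with value at most the current one -/
noncomputable def cnt (x : ℕ → ℝ) (n : ℕ) : ℕ := ∑ k ∈ Finset.range n, open Classical in if x k ≤ x n then 1 else 0

open Classical in
lemma cnt_eq_card (x : ℕ → ℝ) (n : ℕ) :
    cnt x n = ((Finset.range n).filter (fun k => x k ≤ x n)).card := by
  rw [cnt, Finset.card_filter]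

lemma cnt_le (x : ℕ → ℝ) (n : ℕ) : cnt x n ≤ n := by
  classical
  rw [cnt_eq_card]
  exact (Finset.card_filter_le _ _).trans (by simp)

/-- the encoding -/
noncomputable def code (x : ℕ → ℝ) (n : ℕ) : Fin (n + 1) := ⟨cnt x n, Nat.lt_succ_of_le (cnt_le x n)⟩

/-- the shift -/
def shift (x : ℕ → ℝ) (n : ℕ) : ℝ := x (n + 1)

lemma measurable_cnt (n : ℕ) : Measurable (fun x : ℕ → ℝ => cnt x n) := by
  classical
  unfold cnt
  refine Finset.measurable_sum _ fun k _ => ?_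
  refine Measurable.ite ?_ measurable_const measurable_const
  exact measurableSet_le (measurable_pi_apply k) (measurable_pi_apply n)

lemma measurable_code : Measurable code := by
  refine measurable_pi_iff.2 fun n => ?_
  have : (fun x => code x n) = (Fin.ofNat (n + 1)) ∘ (fun x => cnt x n) := by
    funext x
    apply Fin.ext
    simp [code, Fin.ofNat, Nat.mod_eq_of_lt (Nat.lt_succ_of_le (cnt_le x n))]
  rw [this]
  exact Measurable.of_discrete.comp (measurable_cnt n)

lemma measurable_shift : Measurable shift :=
  measurable_pi_iff.2 fun n => measurable_pi_apply (n + 1)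

lemma measurable_dM (n : ℕ) : Measurable (fun t => dM t n) := by
  induction n with
  | zero => exact measurable_const
  | succ n ih =>
    have : (fun t => dM t (n + 1)) =
        (fun p : Fin (n + 2) × ℕ => if (p.1 : ℕ) ≤ p.2 then p.2 + 1 else p.2) ∘
          (fun t : ∀ n : ℕ, Fin (n + 1) => (t (n + 1), dM t n)) := by
      funext t; rfl
    rw [this]
    exact Measurable.of_discrete.comp ((measurable_pi_apply (n + 1)).prodMk ih)

lemma measurable_transferM : Measurable transferM := by
  refine measurable_pi_iff.2 fun n => ?_
  have : (fun t => transferM t n) =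
      (fun p : Fin (n + 2) × ℕ => Fin.ofNat (n + 1) (if (p.1 : ℕ) ≤ p.2 then (p.1 : ℕ) else (p.1 : ℕ) - 1)) ∘
        (fun t : ∀ n : ℕ, Fin (n + 1) => (t (n + 1), dM t n)) := by
    funext t
    apply Fin.ext
    have h1 := dM_le t n
    have h2 := (t (n + 1)).isLt
    simp only [transferM, Function.comp, Fin.ofNat]
    split_ifs with h
    · exact (Nat.mod_eq_of_lt (by omega)).symm
    · exact (Nat.mod_eq_of_lt (by omega)).symm
  rw [this]
  exact Measurable.of_discrete.comp ((measurable_pi_apply (n + 1)).prodMk (measurable_dM n))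

open Classical in
/-- rank of the first element -/
noncomputable def rk (x : ℕ → ℝ) (n : ℕ) : ℕ := ((Finset.range (n + 1)).filter (fun k => x k < x 0)).card

lemma cnt_le_rk (x : ℕ → ℝ) (n : ℕ) : cnt x (n + 1) ≤ rk x n ↔ x (n + 1) < x 0 := by
  classical
  rw [cnt_eq_card, rk]
  constructor
  · intro h
    by_contra! hx
    refine absurd h (not_le.2 (Finset.card_lt_card ?_))
    refine Finset.ssubset_iff_of_subset ?_ |>.2 ⟨0, ?_, ?_⟩
    · intro k hk
      simp only [Finset.mem_filter] at hk ⊢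
      exact ⟨hk.1, hk.2.le.trans hx⟩
    · simp [hx]
    · simp
  · intro h
    apply Finset.card_le_card
    intro k hk
    simp only [Finset.mem_filter] at hk ⊢
    exact ⟨hk.1, hk.2.trans_lt h⟩

lemma dM_code (x : ℕ → ℝ) (n : ℕ) : dM (code x) n = rk x n := by
  classical
  induction n with
  | zero =>
    symm
    simp only [dM, rk, Finset.card_eq_zero, Finset.filter_eq_empty_iff]
    intro k hk
    obtain rfl : k = 0 := by simpa using hk
    exact lt_irrefl _
  | succ n ih =>
    rw [dM, ih]
    have : ((code x (n + 1) : Fin (n + 2)) : ℕ) = cnt x (n + 1) := rfl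
    rw [this]
    simp only [cnt_le_rk]
    have h2 : rk x (n + 1) = rk x n + if x (n + 1) < x 0 then 1 else 0 := by
      simp only [rk, Finset.card_filter]
      rw [Finset.sum_range_succ]
    rw [h2]
    split_ifs <;> rfl

lemma cnt_shift (x : ℕ → ℝ) (n : ℕ) [Decidable (x 0 ≤ x (n + 1))] :
    cnt x (n + 1) = cnt (shift x) n + if x 0 ≤ x (n + 1) then 1 else 0 := by
  classical
  simp only [cnt, shift]
  rw [Finset.sum_range_succ']
  congr

lemma semiconj : Function.Semiconj code shift transferM := by
  classical
  intro x
  funext n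
  apply Fin.ext
  have h1 := cnt_shift x n
  have h2 := cnt_le_rk x n
  have h3 : ((code x (n + 1) : Fin (n + 2)) : ℕ) = cnt x (n + 1) := rfl
  simp only [transferM, dM_code, h3]
  change cnt (shift x) n = _
  split_ifs with h
  · have := h2.1 h
    rw [if_neg (not_le.2 this)] at h1
    simp [h1]
  · have : x 0 ≤ x (n + 1) := not_lt.1 (fun h' => h (h2.2 h'))
    rw [if_pos this] at h1
    simp [h1]

/-- The code determines the order type. -/
lemma order_of_code (x y : ℕ → ℝ) (n : ℕ)
    (hx : ∀ i ≤ n, ∀ j ≤ n, x i = x j → i = j) (hy : ∀ i ≤ n, ∀ j ≤ n, y i = y j → i = j)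
    (h : ∀ i ≤ n, cnt x i = cnt y i) :
    ∀ m ≤ n, ∀ i ≤ m, ∀ j ≤ m, x i < x j ↔ y i < y j := by
  classical
  intro m
  induction m with
  | zero => intro _ i hi j hj; simp_all
  | succ m ih =>
    intro hm
    have ih := ih (by omega)
    have key : ∀ (u v : ℕ → ℝ), (∀ i ≤ m, ∀ j ≤ m, u i < u j ↔ v i < v j) →
        cnt u (m + 1) = cnt v (m + 1) → ∀ i ≤ m, u i ≤ u (m + 1) → v i ≤ v (m + 1) := by
      intro u v huv hc i hi hui
      by_contra! hv
      rw [cnt_eq_card, cnt_eq_card] at hc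
      refine absurd hc (ne_of_gt (Finset.card_lt_card ?_))
      refine Finset.ssubset_iff_of_subset ?_ |>.2 ⟨i, ?_, ?_⟩
      · intro k hk
        simp only [Finset.mem_filter, Finset.mem_range] at hk ⊢
        exact ⟨hk.1, (((huv k (by omega) i hi).2 (hk.2.trans_lt hv)).le).trans hui⟩
      · simp [hui]; omega
      · simp [hv]
    have key2 : ∀ i ≤ m, x i ≤ x (m + 1) ↔ y i ≤ y (m + 1) := fun i hi =>
      ⟨key x y ih (h _ hm) i hi, key y x (fun i hi j hj => (ih i hi j hj).symm) (h _ hm).symm i hi⟩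
    intro i hi j hj
    rcases Nat.lt_or_ge m i with hi' | hi'
    · obtain rfl : i = m + 1 := by omega
      rcases Nat.lt_or_ge m j with hj' | hj'
      · obtain rfl : j = m + 1 := by omega
        simp
      · simpa using not_congr (key2 j hj')
    · rcases Nat.lt_or_ge m j with hj' | hj'
      · obtain rfl : j = m + 1 := by omega
        have a : x i ≠ x (m + 1) := fun e => by
          have := hx i (by omega) _ hm e; omega
        have b : y i ≠ y (m + 1) := fun e => by
          have := hy i (by omega) _ hm e; omega
        rw [lt_iff_le_and_ne, lt_iff_le_and_ne, key2 i hi']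
        simp [a, b]
      · exact ih i hi' j hj'

/-- Points with code `a` up to `n` and distinct coordinates. -/
def cell (n : ℕ) (a : ∀ i : Finset.Iic n, Fin (i.1 + 1)) : Set (ℕ → ℝ) :=
  {x | Preorder.frestrictLe (π := fun i => Fin (i + 1)) n (code x) = a ∧
    ∀ i ≤ n, ∀ j ≤ n, x i = x j → i = j}

lemma perm_unique (n : ℕ) (x : ℕ → ℝ) (σ : Equiv.Perm (Finset.Iic n))
    (hx : ∀ i j : Finset.Iic n, x i.1 = x j.1 → i = j)
    (h : ∀ i j : Finset.Iic n, x i.1 < x j.1 ↔ x (σ i).1 < x (σ j).1) : σ = 1 := by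
  classical
  refine Equiv.ext fun i => ?_
  have hc : ∀ i, (Finset.univ.filter (fun j : Finset.Iic n => x j.1 < x i.1)).card =
      (Finset.univ.filter (fun j : Finset.Iic n => x j.1 < x (σ i).1)).card := by
    intro i
    refine Finset.card_bij (fun j _ => σ j) ?_ ?_ ?_
    · intro j hj; simpa [← h] using hj
    · intro j _ k _ e; exact σ.injective e
    · intro j hj
      refine ⟨σ.symm j, ?_, by simp⟩
      simp only [Finset.mem_filter, Finset.mem_univ, true_and] at hj ⊢
      rw [h, Equiv.apply_symm_apply]
      exact hj
  have lt_of : ∀ i k : Finset.Iic n, x i.1 < x k.1 →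
      (Finset.univ.filter (fun j : Finset.Iic n => x j.1 < x i.1)).card <
      (Finset.univ.filter (fun j : Finset.Iic n => x j.1 < x k.1)).card := by
    intro i k hik
    refine Finset.card_lt_card (Finset.ssubset_iff_of_subset ?_ |>.2 ⟨i, ?_, ?_⟩)
    · intro j hj
      simp only [Finset.mem_filter, Finset.mem_univ, true_and] at hj ⊢
      exact hj.trans hik
    · simpa using hik
    · simp
  apply hx
  rcases lt_trichotomy (x (σ i).1) (x i.1) with h1 | h1 | h1
  · have := lt_of _ _ h1; have := hc i; omega
  · exact h1
  · have := lt_of _ _ h1; have := hc i; omega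

variable (p : Measure ℝ) [IsProbabilityMeasure p]

lemma map_inj (f : ℕ → ℕ) (hf : Function.Injective f) :
    MeasurePreserving (fun (x : ℕ → ℝ) i => x (f i)) (Measure.infinitePi fun _ : ℕ => p)
      (Measure.infinitePi fun _ : ℕ => p) :=
  ⟨measurable_pi_iff.2 fun n => measurable_pi_apply (f n), by
    simpa using Measure.map_infinitePi_infinitePi_of_inj (P := fun _ : ℕ => p) hf⟩

lemma measurableSet_cell (n : ℕ) (a) : MeasurableSet (cell n a) := by
  have : cell n a = (fun x => Preorder.frestrictLe (π := fun i => Fin (i + 1)) n (code x)) ⁻¹' {a} ∩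
      ⋂ i, ⋂ (_ : i ≤ n), ⋂ j, ⋂ (_ : j ≤ n), {x | x i = x j → i = j} := by
    ext x; simp [cell]
  rw [this]
  refine ((Preorder.measurable_frestrictLe n).comp measurable_code (measurableSet_singleton a)).inter ?_
  refine MeasurableSet.iInter fun i => MeasurableSet.iInter fun _ => MeasurableSet.iInter fun j =>
    MeasurableSet.iInter fun _ => ?_
  by_cases h : i = j
  · simp [h]
  · simp only [h, imp_false]
    exact (measurableSet_eq_fun (measurable_pi_apply i) (measurable_pi_apply j)).compl

lemma cell_disjoint (n : ℕ) (a) (σ τ : Equiv.Perm (Finset.Iic n)) (hne : σ ≠ τ) (x : ℕ → ℝ)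
    (h1 : (fun i => x (Equiv.Perm.ofSubtype σ i)) ∈ cell n a)
    (h2 : (fun i => x (Equiv.Perm.ofSubtype τ i)) ∈ cell n a) : False := by
  apply hne
  have hc : ∀ i ≤ n, cnt (fun i => x (Equiv.Perm.ofSubtype σ i)) i =
      cnt (fun i => x (Equiv.Perm.ofSubtype τ i)) i := by
    intro i hi
    have := congrFun (h1.1.trans h2.1.symm) ⟨i, Finset.mem_Iic.2 hi⟩
    exact congrArg Fin.val this
  have ho := order_of_code _ _ n h1.2 h2.2 hc n le_rfl
  have hs : ∀ (σ : Equiv.Perm (Finset.Iic n)) (i : Finset.Iic n),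
      Equiv.Perm.ofSubtype σ (i : ℕ) = (σ i : ℕ) := fun σ i => Equiv.Perm.ofSubtype_apply_coe σ i
  have hτσ : σ⁻¹ * τ = 1 := by
    refine perm_unique n (fun i => x (Equiv.Perm.ofSubtype σ i)) _ ?_ ?_
    · intro i j hij
      exact Subtype.ext (h1.2 i (Finset.mem_Iic.1 i.2) j (Finset.mem_Iic.1 j.2) hij)
    · intro i j
      have := ho i (Finset.mem_Iic.1 i.2) j (Finset.mem_Iic.1 j.2)
      simp only [hs] at this ⊢
      simpa using this
  exact (inv_mul_eq_one.1 hτσ)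

lemma cell_le (n : ℕ) (a) :
    ((n + 1).factorial : ENNReal) * (Measure.infinitePi fun _ : ℕ => p) (cell n a) ≤ 1 := by
  classical
  set ν := Measure.infinitePi fun _ : ℕ => p
  let S : Equiv.Perm (Finset.Iic n) → Set (ℕ → ℝ) := fun σ =>
    (fun (x : ℕ → ℝ) i => x (Equiv.Perm.ofSubtype σ i)) ⁻¹' cell n a
  have hmp : ∀ σ : Equiv.Perm (Finset.Iic n),
      MeasurePreserving (fun (x : ℕ → ℝ) i => x (Equiv.Perm.ofSubtype σ i)) ν ν :=
    fun σ => map_inj p _ (Equiv.injective _)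
  have hS : ∀ σ, ν (S σ) = ν (cell n a) := fun σ =>
    (hmp σ).measure_preimage (measurableSet_cell n a).nullMeasurableSet
  have hU : ν (⋃ σ, S σ) = ∑ σ, ν (S σ) := by
    rw [measure_iUnion, tsum_fintype]
    · intro σ τ hne
      exact Set.disjoint_left.2 fun x h1 h2 => cell_disjoint n a σ τ hne x h1 h2
    · exact fun σ => (hmp σ).measurable (measurableSet_cell n a)
  simp only [hS, Finset.sum_const, Finset.card_univ, Fintype.card_perm, Fintype.card_coe,
    Nat.card_Iic, nsmul_eq_mul] at hU
  rw [← hU]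
  exact prob_le_one

lemma ae_distinct [NullSingletonClass p] :
    ∀ᵐ x ∂(Measure.infinitePi fun _ : ℕ => p), ∀ i j : ℕ, x i = x j → i = j := by
  rw [ae_all_iff]; intro i
  rw [ae_all_iff]; intro j
  by_cases h : i = j
  · simp [h]
  simp only [h, imp_false]
  have hm : Measurable (fun x : ℕ → ℝ => (x i, x j)) := by fun_prop
  have hd : MeasurableSet {q : ℝ × ℝ | q.1 = q.2} :=
    measurableSet_eq_fun measurable_fst measurable_snd
  have h0 : (p.prod p) {q : ℝ × ℝ | q.1 = q.2} = 0 := by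
    rw [Measure.measure_prod_null hd]
    refine Filter.Eventually.of_forall fun a => ?_
    have : Prod.mk a ⁻¹' {q : ℝ × ℝ | q.1 = q.2} = {a} := by ext b; simp [eq_comm]
    change p (Prod.mk a ⁻¹' {q : ℝ × ℝ | q.1 = q.2}) = 0
    rw [this]; simp
  rw [← Measure.infinitePi_map_eval_prod (P := fun _ : ℕ => p) h, Measure.map_apply hm hd] at h0
  rw [ae_iff]
  simpa using h0

instance (n : ℕ) : IsProbabilityMeasure (uniformFin n) := by
  unfold uniformFin; infer_instance

lemma prod_uniform (n : ℕ) (a : ∀ i : Finset.Iic n, Fin (i.1 + 1)) :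
    (Measure.pi fun i : Finset.Iic n => uniformFin i) {a} = ((n + 1).factorial : ENNReal)⁻¹ := by
  rw [Measure.pi_singleton]
  have : ∀ i : Finset.Iic n, uniformFin i {a i} = (((i : ℕ) + 1 : ℕ) : ENNReal)⁻¹ := by
    intro i
    rw [uniformFin, PMF.toMeasure_apply_singleton _ _ (measurableSet_singleton _)]
    simp
  simp only [this]
  rw [Finset.prod_coe_sort (Finset.Iic n) (fun i => (((i : ℕ) + 1 : ℕ) : ENNReal)⁻¹)]
  have h2 : Finset.Iic n = Finset.range (n + 1) := by ext; simp
  rw [h2, ← Finset.prod_range_add_one_eq_factorial, Nat.cast_prod, ENNReal.prod_inv_distrib]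
  intro i _ j _ _
  simp

lemma code_law [NullSingletonClass p] :
    IsProjectiveLimit ((Measure.infinitePi fun _ : ℕ => p).map code)
      (fun J : Finset ℕ => Measure.pi fun n : J => uniformFin n) := by
  rw [isProjectiveLimit_nat_iff (isProjectiveMeasureFamily_pi (fun n => uniformFin n))]
  intro n
  have hm := Preorder.measurable_frestrictLe (X := fun i => Fin (i + 1)) n
  have := Measure.isProbabilityMeasure_map (μ := Measure.infinitePi fun _ : ℕ => p)
    measurable_code.aemeasurable
  have := Measure.isProbabilityMeasure_map (μ := (Measure.infinitePi fun _ : ℕ => p).map code)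
    hm.aemeasurable
  refine Measure.eq_of_le_of_isProbabilityMeasure ?_
  have hs : ∀ a, (((Measure.infinitePi fun _ : ℕ => p).map code).map
      (Preorder.frestrictLe (π := fun i => Fin (i + 1)) n)) {a} ≤
      (Measure.pi fun i : Finset.Iic n => uniformFin i) {a} := by
    intro a
    rw [prod_uniform, Measure.map_apply hm (measurableSet_singleton a),
      Measure.map_apply measurable_code (hm (measurableSet_singleton a)),
      ENNReal.le_inv_iff_mul_le, mul_comm]
    refine le_trans ?_ (cell_le p n a)
    refine mul_le_mul_right (measure_mono_ae ?_) _
    filter_upwards [ae_distinct p] with x hx hxa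
    exact ⟨hxa, fun i _ j _ => hx i j⟩
  refine Measure.le_iff.2 fun s _ => ?_
  rw [← Set.biUnion_of_singleton s, measure_biUnion s.to_countable, measure_biUnion s.to_countable]
  · exact ENNReal.tsum_le_tsum fun a => hs a
  all_goals first
    | exact fun a _ b _ h => Set.disjoint_singleton.2 h
    | exact fun a _ => measurableSet_singleton a

lemma shift_ergodic : Ergodic shift (Measure.infinitePi fun _ : ℕ => p) := by
  refine ⟨map_inj p (fun i => i + 1) (add_left_injective 1), ⟨fun s hs hinv => ?_⟩⟩
  have hind : iIndepFun (fun (i : ℕ) (x : ℕ → ℝ) => x i) (Measure.infinitePi fun _ : ℕ => p) :=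
    iIndepFun_infinitePi (X := fun _ x => x) (by fun_prop)
  have hit : ∀ n, (fun (x : ℕ → ℝ) i => x (i + n)) ⁻¹' s = s := by
    intro n
    induction n with
    | zero => rfl
    | succ n ih =>
      conv_rhs => rw [← ih, ← hinv]
      rw [← Set.preimage_comp]
      congr 1
      funext x i
      simp only [Function.comp, shift]
      congr 1; omega
  have h01 := measure_zero_or_one_of_measurableSet_limsup_atTop
    (fun n => (measurable_pi_apply n).comap_le) hind (t := s) ?_
  · rw [Filter.eventuallyConst_set']
    rcases h01 with h | h
    · left; exact ae_eq_empty.2 h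
    · right; rw [ae_eq_univ, prob_compl_eq_zero_iff hs]; exact h
  · rw [Filter.limsup_eq_iInf_iSup_of_nat', MeasurableSpace.measurableSet_iInf]
    intro n
    rw [← hit n]
    refine @measurable_pi_lambda _ _ _ (_) _ _ (fun i => ?_) s hs
    rw [measurable_iff_comap_le]
    exact le_iSup (fun i => MeasurableSpace.comap (fun x : ℕ → ℝ => x (i + n)) _) i

end TransferAux

open TransferAux in
/-- The transfer `Λ` is a measurable, measure-preserving and ergodic transformation of the
triangular compact set `𝔐 = ∏_n {0,…,n}` equipped with the product `μ` of the uniform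
measures on the factors (characterized as the projective limit of the finite products
of uniform measures). -/
theorem transferM_measurePreserving_ergodic
    (μ : Measure (∀ n : ℕ, Fin (n + 1)))
    (hμ : IsProjectiveLimit μ (fun J : Finset ℕ => Measure.pi fun n : J => uniformFin n)) :
    Measurable transferM ∧ MeasurePreserving transferM μ μ ∧ Ergodic transferM μ := by
  let p : Measure ℝ := volume.restrict (Set.Icc 0 1)
  have : IsProbabilityMeasure p := ⟨by simp [p]⟩
  have : NullSingletonClass p := by unfold p; infer_instance
  have hlaw : (Measure.infinitePi fun _ : ℕ => p).map code = μ := (code_law p).unique hμ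
  have hE : MeasurePreserving code (Measure.infinitePi fun _ : ℕ => p) μ := ⟨measurable_code, hlaw⟩
  have herg : Ergodic transferM μ := by
    have hpre := hE.preErgodic_of_preErgodic_semiconj (shift_ergodic p).toPreErgodic semiconj
    refine ⟨⟨measurable_transferM, ?_⟩, hpre⟩
    rw [← hlaw, Measure.map_map measurable_transferM measurable_code, ← semiconj.comp_eq,
      ← Measure.map_map measurable_code measurable_shift,
      (shift_ergodic p).toMeasurePreserving.map_eq]
  exact ⟨measurable_transferM, herg.toMeasurePreserving, herg⟩
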